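/- Let φ = (1+√5)/2. For every ε ∈ (0,φ) and every budget B > 0, there is no deterministic mechanism on n = 2 agents that satisfies NP, IR, BF and WNOM and is (φ−ε)-approximate for the additive valuation with values v_1 = φ, v_2 = 1, i.e., no such M satisfies (φ−ε)·(φ·x_1(c) + x_2(c)) ≥ max{φ·x'_1 + x'_2 : x' ∈ {0,1}^2, c_1·x'_1 + c_2·x'_2 ≤ B} for all c ∈ [0,B]^2. -/

import Mathlib

open Finset

/-- The set of declared cost profiles lying in the box `[0,B]^n`. -/
def InBox {n : ℕ} (B : ℝ) (c : Fin n → ℝ) : Prop := ∀ i, c i ∈ Set.Icc (0:ℝ) B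

/-- The set of utilities agent `i` with true cost `t` can experience when reporting `ci`,
as the reports of the other agents range over `[0,B]^{n-1}`. -/
def utilSet {n : ℕ} (B : ℝ) (x p : (Fin n → ℝ) → Fin n → ℝ) (i : Fin n) (t ci : ℝ) :
    Set ℝ :=
  {u | ∃ c : Fin n → ℝ, c i = ci ∧ (∀ j, j ≠ i → c j ∈ Set.Icc (0:ℝ) B) ∧
    u = p c i - t * x c i}

/-- Best-case non-obvious manipulability. -/
def BNOM {n : ℕ} (B : ℝ) (x p : (Fin n → ℝ) → Fin n → ℝ) : Prop :=
  ∀ i : Fin n, ∀ t ∈ Set.Icc (0:ℝ) B, ∀ ci ∈ Set.Icc (0:ℝ) B,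
    sSup (utilSet B x p i t ci) ≤ sSup (utilSet B x p i t t)

/-- Worst-case non-obvious manipulability. -/
def WNOM {n : ℕ} (B : ℝ) (x p : (Fin n → ℝ) → Fin n → ℝ) : Prop :=
  ∀ i : Fin n, ∀ t ∈ Set.Icc (0:ℝ) B, ∀ ci ∈ Set.Icc (0:ℝ) B,
    sInf (utilSet B x p i t ci) ≤ sInf (utilSet B x p i t t)

/-- The golden ratio `φ = (1 + √5)/2`. -/
noncomputable def phi : ℝ := (1 + Real.sqrt 5) / 2

theorem phi_pos : 0 < phi := by
  unfold phi
  positivity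

theorem phi_sq : phi * phi = phi + 1 := by
  unfold phi
  nlinarith [Real.mul_self_sqrt (show (0:ℝ) ≤ 5 by norm_num)]

/-- For every `ε ∈ (0,φ)` and budget `B > 0`, no deterministic
mechanism on two agents satisfying NP, IR, BF and WNOM is `(φ-ε)`-approximate for the
additive valuation with values `v₁ = φ` and `v₂ = 1`. -/
theorem no_wnom_phi_minus_eps (ε B : ℝ) (hε : 0 < ε) (hεφ : ε < phi) (hB : 0 < B) :
    ¬ ∃ x p : (Fin 2 → ℝ) → Fin 2 → ℝ,
      (∀ c, InBox B c → ∀ i, x c i = 0 ∨ x c i = 1) ∧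
      (∀ c, InBox B c → ∀ i, 0 ≤ p c i) ∧
      (∀ c, InBox B c → ∀ i, x c i = 0 → p c i = 0) ∧
      (∀ c, InBox B c → ∀ i, c i * x c i ≤ p c i) ∧
      (∀ c, InBox B c → ∑ i, p c i ≤ B) ∧
      WNOM B x p ∧
      (∀ c, InBox B c → ∀ y : Fin 2 → ℝ, (∀ i, y i = 0 ∨ y i = 1) →
        c 0 * y 0 + c 1 * y 1 ≤ B →
        phi * y 0 + y 1 ≤ (phi - ε) * (phi * x c 0 + x c 1)) := by
  rintro ⟨x, p, hx, hp, -, hIR, hBF, hW, hA⟩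
  have hφ := phi_pos
  have hx0 : ∀ c, InBox B c → x c 0 = 1 := by
    intro c hc
    refine (hx c hc 0).resolve_left fun h0 => ?_
    have h := hA c hc ![1, 0] (by simp [Fin.forall_fin_two]) (by simpa using (hc 0).2)
    rcases hx c hc 1 with h1 | h1 <;> simp [h0, h1] at h <;> linarith
  have hbox : ∀ c : Fin 2 → ℝ, c 0 ∈ Set.Icc (0:ℝ) B →
      (∀ j, j ≠ 0 → c j ∈ Set.Icc (0:ℝ) B) → InBox B c := by
    intro c h0 h j
    by_cases hj : j = 0
    · exact hj ▸ h0
    · exact h j hj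
  have h0B : (0:ℝ) ∈ Set.Icc (0:ℝ) B := ⟨le_rfl, hB.le⟩
  have hBB : B ∈ Set.Icc (0:ℝ) B := ⟨hB.le, le_rfl⟩
  have hc : InBox B ![0, B / 2] := by
    intro i
    fin_cases i
    · exact h0B
    · constructor <;> simp <;> linarith
  have hx1 : x ![0, B / 2] 1 = 1 := by
    refine (hx _ hc 1).resolve_left fun h1 => ?_
    have h := hA _ hc ![1, 1] (by simp [Fin.forall_fin_two]) (by simp; linarith)
    simp [hx0 _ hc, h1] at h
    nlinarith [phi_sq, mul_pos hε hφ]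
  have hlow : B ≤ sInf (utilSet B x p 0 0 B) := by
    apply le_csInf
    · exact ⟨_, fun _ => B, rfl, fun _ _ => hBB, rfl⟩
    · rintro u ⟨c, hc0, hcj, rfl⟩
      have hb := hbox c (hc0 ▸ hBB) hcj
      have := hIR c hb 0
      rw [hx0 c hb, hc0] at this
      linarith
  have hup : sInf (utilSet B x p 0 0 0) ≤ p ![0, B / 2] 0 := by
    apply csInf_le
    · refine ⟨0, ?_⟩
      rintro u ⟨c, hc0, hcj, rfl⟩
      have := hp c (hbox c (hc0 ▸ h0B) hcj) 0
      linarith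
    · exact ⟨![0, B / 2], rfl, fun j _ => hc j, by ring⟩
  have hmid := hW 0 0 h0B B hBB
  have hpay := hIR _ hc 1
  have hsum := hBF _ hc
  rw [hx1] at hpay
  rw [Fin.sum_univ_two] at hsum
  simp at hpay
  linarith
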